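/- arXiv:1805.09608 — 2 statements merged into one kernel-verified Lean document; each statement's English description precedes it below -/
import Mathlib

section
/- Let G be a discrete group. Then: (1) G is compactly covered if and only if G is torsion; (2) the family B(G) of finite subgroups of G is cofinal in the family C(G) of finite subsets of G containing the identity if and only if G is locally finite; (3) the family N(G) of finite normal subgroups of G is cofinal in C(G) (i.e., G is strongly compactly covered) if and only if G is a torsion FC-group. -/
open Pointwise Filter Topology

/-- The family of compact neighborhoods of the identity; for a discrete group these are
exactly the finite subsets containing the identity. -/
def compNhds (G : Type*) [TopologicalSpace G] [One G] : Set (Set G) :=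
  {K | IsCompact K ∧ K ∈ nhds 1}

/-- A topological group is compactly covered if every element lies in a compact subgroup. -/
def CompactlyCovered (G : Type*) [Group G] [TopologicalSpace G] : Prop :=
  ∀ g : G, ∃ K : Subgroup G, IsCompact (K : Set G) ∧ g ∈ K

/-- A group is locally finite if every finite subset generates a finite subgroup. -/
def LocallyFiniteGroup (G : Type*) [Group G] : Prop :=
  ∀ S : Finset G, ((Subgroup.closure (S : Set G) : Subgroup G) : Set G).Finite

theorem Subgroup.finiteIndex_centralizer_singleton {G : Type*} [Group G] {g : G}
    (hg : (conjugatesOf g).Finite) : (Subgroup.centralizer {g}).FiniteIndex := by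
  have horbit : MulAction.orbit (ConjAct G) g = conjugatesOf g := by
    ext y
    rw [ConjAct.mem_orbit_conjAct, isConj_comm]
    rfl
  have hindex : (Subgroup.centralizer {g}).index = (MulAction.stabilizer (ConjAct G) g).index :=
    (congrArg Subgroup.index (Subgroup.centralizer_eq_comap_stabilizer g)).trans
      (Subgroup.index_comap_of_surjective _ ConjAct.toConjAct.surjective)
  refine ⟨?_⟩
  rw [hindex, MulAction.index_stabilizer, horbit]
  exact ((Set.ncard_pos hg).2 ⟨g, mem_conjugatesOf_self⟩).ne'

/-- A finitely generated subgroup of a torsion group is finite as soon as its generators have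
finite conjugacy classes. -/
theorem Subgroup.finite_closure_of_finite_conjugatesOf {G : Type*} [Group G]
    (ht : IsMulTorsion G) {s : Set G} (hs : s.Finite)
    (hconj : ∀ g ∈ s, (conjugatesOf g).Finite) : Finite (Subgroup.closure s) := by
  have := hs.to_subtype
  have hC : (Subgroup.centralizer s).FiniteIndex := by
    rw [Subgroup.centralizer_eq_iInf, ← iInf_subtype'']
    exact Subgroup.finiteIndex_iInf fun g =>
      Subgroup.finiteIndex_centralizer_singleton (hconj g g.2)
  let Z := (Subgroup.centralizer s).subgroupOf (Subgroup.closure s)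
  have hcomm : ∀ a b : Z, a * b = b * a := fun a b => by
    have ha : ((a : Subgroup.closure s) : G) ∈ Subgroup.centralizer (Subgroup.closure s : Set G) :=
      (Subgroup.centralizer_closure s).symm ▸ Subgroup.mem_subgroupOf.1 a.2
    exact Subtype.ext (Subtype.ext (Subgroup.mem_centralizer_iff.1 ha _ b.1.2).symm)
  have hZ : Finite Z :=
    letI : CommGroup Z := { (inferInstance : Group Z) with mul_comm := hcomm }
    CommGroup.finite_of_fg_isMulTorsion Z ((ht.subgroup _).subgroup Z)
  exact (Subgroup.finite_iff_finite_and_finiteIndex Z).2 ⟨hZ, inferInstance⟩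

theorem mem_compNhds_iff {G : Type*} [TopologicalSpace G] [DiscreteTopology G] [One G]
    {X : Set G} : X ∈ compNhds G ↔ X.Finite ∧ 1 ∈ X := by
  simp [compNhds, isCompact_iff_finite]

theorem compactlyCovered_iff_isMulTorsion {G : Type*} [Group G] [TopologicalSpace G]
    [DiscreteTopology G] : CompactlyCovered G ↔ IsMulTorsion G := by
  refine ⟨fun h g => ?_, fun h g => ⟨Subgroup.zpowers g, ?_, Subgroup.mem_zpowers g⟩⟩
  · obtain ⟨K, hK, hg⟩ := h g
    exact finite_zpowers.1 (hK.finite_of_discrete.subset (Subgroup.zpowers_le.2 hg))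
  · exact (finite_zpowers.2 (h g)).isCompact

theorem finite_subgroups_cofinal_iff {G : Type*} [Group G] [TopologicalSpace G]
    [DiscreteTopology G] :
    (∀ X ∈ compNhds G, ∃ B : Subgroup G, (B : Set G).Finite ∧ X ⊆ (B : Set G)) ↔
      LocallyFiniteGroup G := by
  refine ⟨fun h S => ?_, fun h X hX => ?_⟩
  · obtain ⟨B, hB, hSB⟩ := h (insert 1 (S : Set G))
      (mem_compNhds_iff.2 ⟨S.finite_toSet.insert 1, Set.mem_insert _ _⟩)
    exact hB.subset ((Subgroup.closure_le B).2 ((Set.subset_insert _ _).trans hSB))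
  · lift X to Finset G using (mem_compNhds_iff.1 hX).1
    exact ⟨Subgroup.closure X, h X, Subgroup.subset_closure⟩

theorem finite_normal_subgroups_cofinal_iff {G : Type*} [Group G] [TopologicalSpace G]
    [DiscreteTopology G] :
    (∀ X ∈ compNhds G, ∃ N : Subgroup G, N.Normal ∧ (N : Set G).Finite ∧ X ⊆ (N : Set G)) ↔
      (IsMulTorsion G ∧ ∀ g : G, (conjugatesOf g).Finite) := by
  refine ⟨fun h => ?_, fun ⟨ht, hconj⟩ X hX => ?_⟩
  · have hN : ∀ g : G, ∃ N : Subgroup G, N.Normal ∧ (N : Set G).Finite ∧ g ∈ N := fun g => by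
      obtain ⟨N, hN, hfin, hX⟩ := h {1, g} (mem_compNhds_iff.2 ⟨Set.toFinite _, by simp⟩)
      exact ⟨N, hN, hfin, hX (by simp)⟩
    refine ⟨fun g => ?_, fun g => ?_⟩ <;> obtain ⟨N, hN, hfin, hg⟩ := hN g
    · exact finite_zpowers.1 (hfin.subset (Subgroup.zpowers_le.2 hg))
    · exact hfin.subset (Group.conjugates_subset_normal hg)
  · refine ⟨Subgroup.normalClosure X, inferInstance, ?_, Subgroup.subset_normalClosure⟩
    have hfin : (Group.conjugatesOfSet X).Finite :=
      (mem_compNhds_iff.1 hX).1.biUnion fun g _ => hconj g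
    exact Subgroup.finite_closure_of_finite_conjugatesOf ht hfin fun g _ => hconj g

/-- Lemma: for a discrete group `G`:
(1) `G` is compactly covered iff it is torsion;
(2) the finite subgroups are cofinal in the finite subsets containing the identity iff
`G` is locally finite;
(3) the finite normal subgroups are cofinal therein (i.e. `G` is strongly compactly
covered) iff `G` is a torsion FC-group. -/
theorem stmt2 {G : Type*} [Group G] [TopologicalSpace G] [DiscreteTopology G] :
    (CompactlyCovered G ↔ Monoid.IsTorsion G) ∧
    ((∀ X ∈ compNhds G, ∃ B : Subgroup G, (B : Set G).Finite ∧ X ⊆ (B : Set G)) ↔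
      LocallyFiniteGroup G) ∧
    ((∀ X ∈ compNhds G, ∃ N : Subgroup G, N.Normal ∧ (N : Set G).Finite ∧ X ⊆ (N : Set G)) ↔
      (Monoid.IsTorsion G ∧ ∀ g : G, {y : G | IsConj g y}.Finite)) :=
  ⟨compactlyCovered_iff_isMulTorsion, finite_subgroups_cofinal_iff,
    finite_normal_subgroups_cofinal_iff⟩
end

section
/- Let U be a subgroup of a group G and φ an endomorphism of G such that φⁿ(U)·U = U·φⁿ(U) for every n ≥ 1. Then: (1) φᵏ(U)·φᵐ(U) = φᵐ(U)·φᵏ(U) for every k, m ∈ ℕ; (2) for every n ≥ 1, φⁿ(U)·Tₙ = Tₙ·φⁿ(U), and Tₙ is a subgroup of G. Moreover, if U is normal in G (so the above commuting condition is automatically satisfied), then Tₙ is a normal subgroup of T = ⋃_{k≥1} Tₖ for every n ≥ 1. -/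
open Pointwise

/-- The `n`-th `φ`-trajectory of `U`: `Tₙ(φ,U) = U·φ(U)·…·φ^{n-1}(U)` (with `T₀ = {1}`). -/
def traj {G : Type*} [Group G] (φ : G →* G) (U : Set G) : ℕ → Set G
  | 0 => 1
  | n + 1 => traj φ U n * (⇑φ)^[n] '' U

/-- The product of two permutable subgroups is a subgroup. -/
theorem Subgroup.exists_coe_eq_mul_of_commute {G : Type*} [Group G] (H K : Subgroup G)
    (h : Commute (H : Set G) (K : Set G)) : ∃ S : Subgroup G, (S : Set G) = H * K := by
  have hmul : (H * K : Set G) * (H * K) = H * K := by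
    rw [h.symm.mul_mul_mul_comm, coe_mul_coe, coe_mul_coe]
  have hinv : (H * K : Set G)⁻¹ = H * K := by
    rw [mul_inv_rev, inv_coe_set, inv_coe_set, h.eq]
  refine ⟨{ carrier := H * K, mul_mem' := ?_, one_mem' := ?_, inv_mem' := ?_ }, rfl⟩
  · intro a b ha hb
    exact hmul.subset (Set.mul_mem_mul ha hb)
  · exact ⟨1, H.one_mem, 1, K.one_mem, mul_one 1⟩
  · intro a ha
    exact hinv.subset (Set.inv_mem_inv.2 ha)

theorem exists_subgroup_coe_eq_iterate_image {G : Type*} [Group G] (φ : G →* G)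
    (U : Subgroup G) (n : ℕ) : ∃ K : Subgroup G, (K : Set G) = (⇑φ)^[n] '' (U : Set G) := by
  induction n with
  | zero => exact ⟨U, (Set.image_id _).symm⟩
  | succ n ih =>
    obtain ⟨K, hK⟩ := ih
    exact ⟨K.map φ, by rw [Subgroup.coe_map, hK, Function.iterate_succ', Set.image_comp]⟩

theorem iterate_image_mul {G : Type*} [Group G] (φ : G →* G) (n : ℕ) (A B : Set G) :
    (⇑φ)^[n] '' (A * B) = (⇑φ)^[n] '' A * (⇑φ)^[n] '' B :=
  Set.image_image2_distrib fun a b => iterate_map_mul φ n a b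

theorem commute_iterate_image {G : Type*} [Group G] (φ : G →* G) (U : Set G)
    (hcomm : ∀ n : ℕ, 1 ≤ n → Commute ((⇑φ)^[n] '' U) U) (k m : ℕ) :
    Commute ((⇑φ)^[k] '' U) ((⇑φ)^[m] '' U) := by
  wlog hkm : m ≤ k generalizing k m
  · exact (this m k (le_of_not_ge hkm)).symm
  obtain ⟨d, rfl⟩ := Nat.exists_eq_add_of_le hkm
  rcases Nat.eq_zero_or_pos d with rfl | hd
  · exact Commute.refl _
  · rw [Function.iterate_add, Set.image_comp, commute_iff_eq, ← iterate_image_mul,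
      ← iterate_image_mul, (hcomm d hd).eq]

theorem commute_iterate_image_traj {G : Type*} [Group G] (φ : G →* G) (U : Set G)
    (hcomm : ∀ k m : ℕ, Commute ((⇑φ)^[k] '' U) ((⇑φ)^[m] '' U)) (k n : ℕ) :
    Commute ((⇑φ)^[k] '' U) (traj φ U n) := by
  induction n with
  | zero => exact Commute.one_right _
  | succ n ih => exact ih.mul_right (hcomm k n)

theorem exists_subgroup_coe_eq_traj {G : Type*} [Group G] (φ : G →* G) (U : Subgroup G)
    (hcomm : ∀ k m : ℕ, Commute ((⇑φ)^[k] '' (U : Set G)) ((⇑φ)^[m] '' (U : Set G))) (n : ℕ) :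
    ∃ S : Subgroup G, (S : Set G) = traj φ (U : Set G) n := by
  induction n with
  | zero => exact ⟨⊥, Subgroup.coe_bot⟩
  | succ n ih =>
    obtain ⟨S, hS⟩ := ih
    have h := commute_iterate_image_traj φ U hcomm n n
    obtain ⟨K, hK⟩ := exists_subgroup_coe_eq_iterate_image φ U n
    rw [← hS, ← hK] at h
    obtain ⟨R, hR⟩ := Subgroup.exists_coe_eq_mul_of_commute _ _ h.symm
    exact ⟨R, by rw [hR, hS, hK, traj]⟩

theorem traj_mono {G : Type*} [Group G] (φ : G →* G) (U : Subgroup G) :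
    Monotone (traj φ (U : Set G)) := by
  refine monotone_nat_of_le_succ fun n x hx => ?_
  exact ⟨x, hx, 1, ⟨1, U.one_mem, iterate_map_one φ n⟩, mul_one x⟩

theorem iterate_image_subset_traj_succ {G : Type*} [Group G] (φ : G →* G) (U : Subgroup G)
    (n : ℕ) : (⇑φ)^[n] '' (U : Set G) ⊆ traj φ (U : Set G) (n + 1) := by
  have h : (1 : G) ∈ traj φ (U : Set G) n := traj_mono φ U (Nat.zero_le n) Set.one_mem_one
  exact fun x hx => ⟨1, h, x, hx, one_mul x⟩

/-- Elements of the range of a high iterate of `φ` normalize the trajectories of a normal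
subgroup. -/
theorem conj_iterate_mem_traj {G : Type*} [Group G] (φ : G →* G) (U : Subgroup G) [U.Normal]
    (m : ℕ) (g : G) (n : ℕ) (hn : n ≤ m) (x : G) (hx : x ∈ traj φ (U : Set G) n) :
    (⇑φ)^[m] g * x * ((⇑φ)^[m] g)⁻¹ ∈ traj φ (U : Set G) n := by
  induction n generalizing x with
  | zero =>
    obtain rfl : x = 1 := hx
    rw [mul_one, mul_inv_cancel]
    exact Set.one_mem_one
  | succ n ih =>
    obtain ⟨y, hy, _, ⟨u, hu, rfl⟩, rfl⟩ := hx
    refine ⟨_, ih (by lia) y hy, (⇑φ)^[m] g * (⇑φ)^[n] u * ((⇑φ)^[m] g)⁻¹, ?_, by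
      simp only [conj_mul]⟩
    obtain ⟨d, rfl⟩ := Nat.exists_eq_add_of_le (show n ≤ m by lia)
    refine ⟨(⇑φ)^[d] g * u * ((⇑φ)^[d] g)⁻¹, Subgroup.Normal.conj_mem inferInstance u hu _, ?_⟩
    rw [iterate_map_mul, iterate_map_mul, iterate_map_inv, Function.iterate_add_apply]

theorem conj_mem_traj {G : Type*} [Group G] (φ : G →* G) (U : Subgroup G) [U.Normal]
    (n : ℕ) (S : Subgroup G) (hS : (S : Set G) = traj φ (U : Set G) n) (k : ℕ) (t : G)
    (ht : t ∈ traj φ (U : Set G) k) (x : G) (hx : x ∈ traj φ (U : Set G) n) :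
    t * x * t⁻¹ ∈ traj φ (U : Set G) n := by
  induction k generalizing t x with
  | zero =>
    obtain rfl : t = 1 := ht
    simpa using hx
  | succ k ih =>
    obtain ⟨s, hs, y, hy, rfl⟩ := ht
    have hyx : y * x * y⁻¹ ∈ traj φ (U : Set G) n := by
      rcases lt_or_ge k n with hkn | hkn
      · have hyn := traj_mono φ U hkn (iterate_image_subset_traj_succ φ U k hy)
        rw [← hS] at hx hyn ⊢
        exact S.mul_mem (S.mul_mem hyn hx) (S.inv_mem hyn)
      · obtain ⟨u, -, rfl⟩ := hy
        exact conj_iterate_mem_traj φ U k u n hkn x hx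
    simpa [mul_assoc] using ih s hs _ hyx

/-- Lemma 3.1: if `U` is a subgroup of `G` and `φ` an endomorphism such that
`φⁿ(U)·U = U·φⁿ(U)` for all `n ≥ 1`, then (1) the images `φᵏ(U)` pairwise commute as sets;
(2) `φⁿ(U)·Tₙ = Tₙ·φⁿ(U)` and `Tₙ` is a subgroup of `G` for every `n ≥ 1`.
Moreover, if `U` is normal in `G` then `Tₙ` is normal in `T = ⋃ₖ Tₖ`. -/
theorem stmt5 {G : Type*} [Group G] (φ : G →* G) (U : Subgroup G)
    (hcomm : ∀ n : ℕ, 1 ≤ n →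
      (⇑φ)^[n] '' (U : Set G) * (U : Set G) = (U : Set G) * (⇑φ)^[n] '' (U : Set G)) :
    (∀ k m : ℕ, (⇑φ)^[k] '' (U : Set G) * (⇑φ)^[m] '' (U : Set G) =
      (⇑φ)^[m] '' (U : Set G) * (⇑φ)^[k] '' (U : Set G)) ∧
    (∀ n : ℕ, 1 ≤ n →
      (⇑φ)^[n] '' (U : Set G) * traj φ (U : Set G) n =
        traj φ (U : Set G) n * (⇑φ)^[n] '' (U : Set G) ∧
      ∃ S : Subgroup G, (S : Set G) = traj φ (U : Set G) n) ∧
    (U.Normal → ∀ n : ℕ, 1 ≤ n → ∀ t ∈ ⋃ k : ℕ, traj φ (U : Set G) (k + 1),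
      ∀ x ∈ traj φ (U : Set G) n, t * x * t⁻¹ ∈ traj φ (U : Set G) n) := by
  have hpair := commute_iterate_image φ (U : Set G) hcomm
  refine ⟨hpair, fun n _ => ⟨commute_iterate_image_traj φ U hpair n n,
    exists_subgroup_coe_eq_traj φ U hpair n⟩, ?_⟩
  intro hU n _ t ht x hx
  obtain ⟨k, hk⟩ := Set.mem_iUnion.1 ht
  obtain ⟨S, hS⟩ := exists_subgroup_coe_eq_traj φ U hpair n
  exact conj_mem_traj φ U n S hS (k + 1) t hk x hx
end
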